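/- arXiv:cs/0005009 — 2 statements merged into one kernel-verified Lean document; each statement's English description precedes it below -/
import Mathlib

section
/- Correctness of the optimised algorithm: a Gr(K_R)-formula φ in NNF is satisfiable if and only if some sequence of applications of the optimised completion rules starting from {x₀ ⊨ φ} results in a complete and clash-free constraint system; moreover every such sequence of rule applications is finite. -/
/-! Core definitions for the graded modal logic Gr(K_R):
syntax, Kripke semantics, NNF, closure, constraint systems,
and the completion rules (optimised and standard). -/

namespace GrK

/-- Gr(K_R)-formulae over propositional atoms (ℕ) and relation names (ℕ).
`ge r n φ` is the counting modality ⟨R⟩_{≥n}φ and `le r n φ` is ⟨R⟩_{≤n}φ. -/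
inductive GFormula : Type where
  | atom : ℕ → GFormula
  | neg  : GFormula → GFormula
  | and  : GFormula → GFormula → GFormula
  | or   : GFormula → GFormula → GFormula
  | ge   : ℕ → ℕ → GFormula → GFormula
  | le   : ℕ → ℕ → GFormula → GFormula
  deriving DecidableEq

/-- A Kripke structure: a nonempty type of worlds, an accessibility relation
for each relation name, and a valuation. -/
structure Kripke where
  W : Type
  nonempty : Nonempty W
  rel : ℕ → W → W → Prop
  val : ℕ → Set W

/-- Satisfaction `M, x ⊨ φ`; the graded modalities count successors
(as a cardinal, to handle infinite structures faithfully). -/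
def GFormula.sat (M : Kripke) : GFormula → M.W → Prop
  | .atom p, x => x ∈ M.val p
  | .neg φ, x => ¬ GFormula.sat M φ x
  | .and φ ψ, x => GFormula.sat M φ x ∧ GFormula.sat M ψ x
  | .or φ ψ, x => GFormula.sat M φ x ∨ GFormula.sat M ψ x
  | .ge r n φ, x => (n : Cardinal) ≤ Cardinal.mk {y : M.W // M.rel r x y ∧ GFormula.sat M φ y}
  | .le r n φ, x => Cardinal.mk {y : M.W // M.rel r x y ∧ GFormula.sat M φ y} ≤ (n : Cardinal)

/-- ♯R^M(x,φ): the number of R-successors of x satisfying φ. -/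
def Kripke.count (M : Kripke) (r : ℕ) (x : M.W) (φ : GFormula) : Cardinal :=
  Cardinal.mk {y : M.W // M.rel r x y ∧ GFormula.sat M φ y}

/-- A formula is satisfiable iff it holds at some world of some Kripke structure. -/
def GFormula.satisfiable (φ : GFormula) : Prop :=
  ∃ (M : Kripke) (x : M.W), GFormula.sat M φ x

/-- Negation normal form: negation occurs only in front of atoms. -/
def GFormula.isNNF : GFormula → Prop
  | .atom _ => True
  | .neg (.atom _) => True
  | .neg _ => False
  | .and φ ψ => GFormula.isNNF φ ∧ GFormula.isNNF ψ
  | .or φ ψ => GFormula.isNNF φ ∧ GFormula.isNNF ψ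
  | .ge _ _ φ => GFormula.isNNF φ
  | .le _ _ φ => GFormula.isNNF φ

/-- ~φ : the NNF of the negation of an NNF formula. -/
def GFormula.nnfNeg : GFormula → GFormula
  | .atom p => .neg (.atom p)
  | .neg φ => φ
  | .and φ ψ => .or φ.nnfNeg ψ.nnfNeg
  | .or φ ψ => .and φ.nnfNeg ψ.nnfNeg
  | .ge r n φ => if n = 0 then .and (.atom 0) (.neg (.atom 0)) else .le r (n - 1) φ
  | .le r n φ => .ge r (n + 1) φ

/-- |φ| : the length of a formula. -/
def GFormula.size : GFormula → ℕ
  | .atom _ => 1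
  | .neg φ => 1 + φ.size
  | .and φ ψ => 1 + φ.size + ψ.size
  | .or φ ψ => 1 + φ.size + ψ.size
  | .ge _ _ φ => 1 + φ.size
  | .le _ _ φ => 1 + φ.size

/-- sub(φ) : the set of subformulae of φ. -/
def GFormula.sub : GFormula → Finset GFormula
  | .atom p => {.atom p}
  | .neg φ => insert (.neg φ) φ.sub
  | .and φ ψ => insert (.and φ ψ) (φ.sub ∪ ψ.sub)
  | .or φ ψ => insert (.or φ ψ) (φ.sub ∪ ψ.sub)
  | .ge r n φ => insert (.ge r n φ) φ.sub
  | .le r n φ => insert (.le r n φ) φ.sub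

/-- Membership in clos(φ): the smallest set containing φ, closed under
immediate subformulae of ∧, ∨ and the graded modalities, and closed under ~. -/
inductive InClos (φ : GFormula) : GFormula → Prop
  | base : InClos φ φ
  | andL {ψ₁ ψ₂} : InClos φ (.and ψ₁ ψ₂) → InClos φ ψ₁
  | andR {ψ₁ ψ₂} : InClos φ (.and ψ₁ ψ₂) → InClos φ ψ₂
  | orL {ψ₁ ψ₂} : InClos φ (.or ψ₁ ψ₂) → InClos φ ψ₁
  | orR {ψ₁ ψ₂} : InClos φ (.or ψ₁ ψ₂) → InClos φ ψ₂
  | ge {r n ψ} : InClos φ (.ge r n ψ) → InClos φ ψ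
  | le {r n ψ} : InClos φ (.le r n ψ) → InClos φ ψ
  | nnfNeg {ψ} : InClos φ ψ → InClos φ ψ.nnfNeg

/-- clos(φ) as a set of formulae. -/
def clos (φ : GFormula) : Set GFormula := {ψ | InClos φ ψ}

/-- A constraint: either `x ⊨ ψ` or `R x y`;
a constraint system (c.s.) is a finite set of constraints. -/
inductive Constraint : Type where
  | sat : ℕ → GFormula → Constraint
  | rel : ℕ → ℕ → ℕ → Constraint
  deriving DecidableEq

/-- The variables occurring in a constraint. -/
def Constraint.vars : Constraint → Finset ℕ
  | .sat x _ => {x}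
  | .rel _ x y => {x, y}

/-- ♯R^S(x,ψ): the number of variables y with {Rxy, y ⊨ ψ} ⊆ S. -/
noncomputable def countS (S : Finset Constraint) (r x : ℕ) (ψ : GFormula) : ℕ :=
  Set.ncard {y : ℕ | Constraint.rel r x y ∈ S ∧ Constraint.sat y ψ ∈ S}

/-- A clash: {x ⊨ p, x ⊨ ¬p} ⊆ S, or x ⊨ ⟨R⟩_{≤n}ψ ∈ S with ♯R^S(x,ψ) > n. -/
def hasClash (S : Finset Constraint) : Prop :=
  (∃ x p, Constraint.sat x (.atom p) ∈ S ∧ Constraint.sat x (.neg (.atom p)) ∈ S) ∨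
  (∃ x r n ψ, Constraint.sat x (.le r n ψ) ∈ S ∧ n < countS S r x ψ)

/-- `y` is a fresh variable w.r.t. S. -/
def freshIn (y : ℕ) (S : Finset Constraint) : Prop := ∀ c ∈ S, y ∉ c.vars

/-- The →∧-rule is applicable to a constraint for x in S. -/
def andApplicable (S : Finset Constraint) (x : ℕ) : Prop :=
  ∃ ψ₁ ψ₂, Constraint.sat x (.and ψ₁ ψ₂) ∈ S ∧
    ¬ (Constraint.sat x ψ₁ ∈ S ∧ Constraint.sat x ψ₂ ∈ S)

/-- The →∨-rule is applicable to a constraint for x in S. -/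
def orApplicable (S : Finset Constraint) (x : ℕ) : Prop :=
  ∃ ψ₁ ψ₂, Constraint.sat x (.or ψ₁ ψ₂) ∈ S ∧
    Constraint.sat x ψ₁ ∉ S ∧ Constraint.sat x ψ₂ ∉ S

/-- One application of the →∧-rule. -/
inductive StepAnd : Finset Constraint → Finset Constraint → Prop
  | mk (S : Finset Constraint) (x : ℕ) (ψ₁ ψ₂ : GFormula)
      (h : Constraint.sat x (.and ψ₁ ψ₂) ∈ S)
      (h2 : ¬ (Constraint.sat x ψ₁ ∈ S ∧ Constraint.sat x ψ₂ ∈ S)) :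
      StepAnd S (insert (Constraint.sat x ψ₁) (insert (Constraint.sat x ψ₂) S))

/-- One application of the →∨-rule. -/
inductive StepOr : Finset Constraint → Finset Constraint → Prop
  | mk (S : Finset Constraint) (x : ℕ) (ψ₁ ψ₂ χ : GFormula)
      (h : Constraint.sat x (.or ψ₁ ψ₂) ∈ S)
      (h1 : Constraint.sat x ψ₁ ∉ S) (h2 : Constraint.sat x ψ₂ ∉ S)
      (hχ : χ = ψ₁ ∨ χ = ψ₂) :
      StepOr S (insert (Constraint.sat x χ) S)

/-- One application of the optimised →≥-rule: if x ⊨ ⟨R⟩_{≥n}ψ ∈ S,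
♯R^S(x,ψ) < n and no →∧/→∨ rule applies to a constraint for x, add (for a
fresh y) the constraints Rxy, y ⊨ ψ, and y ⊨ χᵢ with χᵢ ∈ {ψᵢ, ~ψᵢ} for every
ψᵢ occurring in a graded constraint ⟨R⟩_{⋈m}ψᵢ for x with the same relation R. -/
inductive StepGe : Finset Constraint → Finset Constraint → Prop
  | mk (S S' : Finset Constraint) (x r n : ℕ) (ψ : GFormula) (y : ℕ)
      (f : GFormula → GFormula)
      (h : Constraint.sat x (.ge r n ψ) ∈ S)
      (hc : countS S r x ψ < n)
      (hna : ¬ andApplicable S x) (hno : ¬ orApplicable S x)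
      (hy : freshIn y S)
      (hf : ∀ ψ', f ψ' = ψ' ∨ f ψ' = ψ'.nnfNeg)
      (hS' : (S' : Set Constraint) = (S : Set Constraint) ∪
          {Constraint.rel r x y, Constraint.sat y ψ} ∪
          {c | ∃ ψ' m,
            (Constraint.sat x (.ge r m ψ') ∈ S ∨ Constraint.sat x (.le r m ψ') ∈ S) ∧
            c = Constraint.sat y (f ψ')}) :
      StepGe S S'

/-- One application of any optimised completion rule. -/
def OptStep (S S' : Finset Constraint) : Prop := StepAnd S S' ∨ StepOr S S' ∨ StepGe S S'

/-- The initial constraint system {x₀ ⊨ φ}. -/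
def initCS (x₀ : ℕ) (φ : GFormula) : Finset Constraint := {Constraint.sat x₀ φ}

/-- S is obtained from {x₀ ⊨ φ} by a sequence of optimised rule applications. -/
def OptReach (x₀ : ℕ) (φ : GFormula) (S : Finset Constraint) : Prop :=
  Relation.ReflTransGen OptStep (initCS x₀ φ) S

/-- A c.s. is complete iff no optimised rule is applicable. -/
def OptComplete (S : Finset Constraint) : Prop := ¬ ∃ S', OptStep S S'

/-- The edges of the graph G(S) induced by a c.s. S. -/
def edge (S : Finset Constraint) (x y : ℕ) : Prop := ∃ r, Constraint.rel r x y ∈ S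

/-- The variable x occurs in S (x is a node of G(S)). -/
def occursIn (x : ℕ) (S : Finset Constraint) : Prop := ∃ c ∈ S, x ∈ c.vars

/-- Satisfiability of a constraint system. -/
def csSat (S : Finset Constraint) : Prop :=
  ∃ (M : Kripke) (α : ℕ → M.W),
    (∀ r x y z, Constraint.rel r x y ∈ S → Constraint.rel r x z ∈ S → y ≠ z → α y ≠ α z) ∧
    (∀ x ψ, Constraint.sat x ψ ∈ S → GFormula.sat M ψ (α x)) ∧
    (∀ r x y, Constraint.rel r x y ∈ S → M.rel r (α x) (α y))

/-- The canonical structure M_S induced by a c.s. S (on the variables,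
with accessibility and valuation read off from S). -/
def canonical (S : Finset Constraint) : Kripke where
  W := ℕ
  nonempty := ⟨0⟩
  rel := fun r x y => Constraint.rel r x y ∈ S
  val := fun p => {x | Constraint.sat x (.atom p) ∈ S}

/-- Renaming a variable: `rename y z c` replaces y by z in the constraint c. -/
def Constraint.rename (y z : ℕ) : Constraint → Constraint
  | .sat x ψ => .sat (if x = y then z else x) ψ
  | .rel r a b => .rel r (if a = y then z else a) (if b = y then z else b)

/-- [z/y]S : replace every occurrence of y by z in S. -/
def renameCS (S : Finset Constraint) (y z : ℕ) : Finset Constraint :=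
  S.image (Constraint.rename y z)

/-- The replacement of y by z in S is safe. -/
def safeReplace (S : Finset Constraint) (y z : ℕ) : Prop :=
  ∀ x r n ψ, Constraint.sat x (.ge r n ψ) ∈ S → Constraint.rel r x y ∈ S →
    Constraint.rel r x z ∈ S → n ≤ countS (renameCS S y z) r x ψ

/-- One application of a standard (Hollunder–Baader) completion rule. -/
inductive StdStep : Finset Constraint → Finset Constraint → Prop
  | and (S : Finset Constraint) (x : ℕ) (ψ₁ ψ₂ : GFormula)
      (h : Constraint.sat x (.and ψ₁ ψ₂) ∈ S)
      (h2 : ¬ (Constraint.sat x ψ₁ ∈ S ∧ Constraint.sat x ψ₂ ∈ S)) :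
      StdStep S (insert (Constraint.sat x ψ₁) (insert (Constraint.sat x ψ₂) S))
  | or (S : Finset Constraint) (x : ℕ) (ψ₁ ψ₂ χ : GFormula)
      (h : Constraint.sat x (.or ψ₁ ψ₂) ∈ S)
      (h1 : Constraint.sat x ψ₁ ∉ S) (h2 : Constraint.sat x ψ₂ ∉ S)
      (hχ : χ = ψ₁ ∨ χ = ψ₂) :
      StdStep S (insert (Constraint.sat x χ) S)
  | choose (S : Finset Constraint) (x r n : ℕ) (ψ χ : GFormula) (y : ℕ)
      (h : Constraint.sat x (.ge r n ψ) ∈ S ∨ Constraint.sat x (.le r n ψ) ∈ S)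
      (hr : Constraint.rel r x y ∈ S)
      (h1 : Constraint.sat y ψ ∉ S) (h2 : Constraint.sat y ψ.nnfNeg ∉ S)
      (hχ : χ = ψ ∨ χ = ψ.nnfNeg) :
      StdStep S (insert (Constraint.sat y χ) S)
  | ge (S : Finset Constraint) (x r n : ℕ) (ψ : GFormula) (y : ℕ)
      (h : Constraint.sat x (.ge r n ψ) ∈ S)
      (hc : countS S r x ψ < n)
      (hy : freshIn y S) :
      StdStep S (insert (Constraint.rel r x y) (insert (Constraint.sat y ψ) S))
  | le (S : Finset Constraint) (x r n : ℕ) (ψ : GFormula) (y z : ℕ)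
      (h : Constraint.sat x (.le r n ψ) ∈ S)
      (hc : n < countS S r x ψ)
      (hyz : y ≠ z)
      (h1 : Constraint.rel r x y ∈ S) (h2 : Constraint.rel r x z ∈ S)
      (h3 : Constraint.sat y ψ ∈ S) (h4 : Constraint.sat z ψ ∈ S)
      (hsafe : safeReplace S y z) :
      StdStep S (renameCS S y z)

/-- S is obtained from {x₀ ⊨ φ} by a sequence of standard rule applications. -/
def StdReach (x₀ : ℕ) (φ : GFormula) (S : Finset Constraint) : Prop :=
  Relation.ReflTransGen StdStep (initCS x₀ φ) S

/-- A c.s. is complete (for the standard rules) iff no rule is applicable. -/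
def StdComplete (S : Finset Constraint) : Prop := ¬ ∃ S', StdStep S S'

end GrK

namespace GrK

/-! ### Formulas -/

/-- modal depth -/
def GFormula.md : GFormula → ℕ
  | .atom _ => 0
  | .neg φ => φ.md
  | .and φ ψ => max φ.md ψ.md
  | .or φ ψ => max φ.md ψ.md
  | .ge _ _ φ => φ.md + 1
  | .le _ _ φ => φ.md + 1

lemma mem_sub_self (φ : GFormula) : φ ∈ φ.sub := by
  cases φ <;> simp [GFormula.sub]

lemma sub_trans {φ ψ χ : GFormula} (h1 : χ ∈ ψ.sub) (h2 : ψ ∈ φ.sub) : χ ∈ φ.sub := by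
  induction φ with
  | atom p => simp only [GFormula.sub, Finset.mem_singleton] at h2; subst h2; exact h1
  | neg φ ih | ge r n φ ih | le r n φ ih =>
    simp only [GFormula.sub, Finset.mem_insert] at h2 ⊢
    rcases h2 with h2 | h2
    · subst h2; simpa [GFormula.sub] using h1
    · exact Or.inr (ih h2)
  | and φ φ' ih ih' | or φ φ' ih ih' =>
    simp only [GFormula.sub, Finset.mem_insert, Finset.mem_union] at h2 ⊢
    rcases h2 with h2 | h2 | h2
    · subst h2; simpa [GFormula.sub] using h1
    · exact Or.inr (Or.inl (ih h2))
    · exact Or.inr (Or.inr (ih' h2))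

lemma md_sub {φ ψ : GFormula} (h : ψ ∈ φ.sub) : ψ.md ≤ φ.md := by
  induction φ with
  | atom p => simp only [GFormula.sub, Finset.mem_singleton] at h; subst h; rfl
  | neg φ ih | ge r n φ ih | le r n φ ih =>
    simp only [GFormula.sub, Finset.mem_insert] at h
    rcases h with h | h
    · subst h; rfl
    · have := ih h; simp only [GFormula.md]; omega
  | and φ φ' ih ih' | or φ φ' ih ih' =>
    simp only [GFormula.sub, Finset.mem_insert, Finset.mem_union] at h
    rcases h with h | h | h
    · subst h; rfl
    · have := ih h; simp only [GFormula.md]; omega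
    · have := ih' h; simp only [GFormula.md]; omega

lemma md_nnfNeg (φ : GFormula) : φ.nnfNeg.md ≤ φ.md := by
  induction φ with
  | atom p => simp [GFormula.nnfNeg, GFormula.md]
  | neg φ ih => simp [GFormula.nnfNeg, GFormula.md]
  | and φ φ' ih ih' | or φ φ' ih ih' => simp only [GFormula.nnfNeg, GFormula.md]; omega
  | ge r n φ ih =>
    simp only [GFormula.nnfNeg]
    split_ifs <;> simp [GFormula.md]
  | le r n φ ih => simp [GFormula.nnfNeg, GFormula.md]

lemma sat_nnfNeg (M : Kripke) (φ : GFormula) (x : M.W) :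
    GFormula.sat M φ.nnfNeg x ↔ ¬ GFormula.sat M φ x := by
  induction φ with
  | atom p => simp [GFormula.nnfNeg, GFormula.sat]
  | neg φ ih => simp [GFormula.nnfNeg, GFormula.sat]
  | and φ φ' ih ih' => simp only [GFormula.nnfNeg, GFormula.sat, ih, ih']; tauto
  | or φ φ' ih ih' => simp only [GFormula.nnfNeg, GFormula.sat, ih, ih']; tauto
  | ge r n φ ih =>
    simp only [GFormula.nnfNeg]
    split_ifs with h
    · subst h; simp [GFormula.sat]
    · obtain ⟨m, rfl⟩ := Nat.exists_eq_succ_of_ne_zero h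
      simp only [GFormula.sat, not_le, Nat.succ_eq_add_one, Nat.add_sub_cancel]
      rw [Nat.cast_add_one, ← Cardinal.succ_natCast, Order.lt_succ_iff]
  | le r n φ ih =>
    simp only [GFormula.nnfNeg, GFormula.sat, not_le]
    rw [Nat.cast_add_one, ← Cardinal.succ_natCast, Order.succ_le_iff]

/-! ### Steps -/

/-- description of a non-generating step -/
def LocalStep (S S' : Finset Constraint) (x : ℕ) : Prop :=
  (∀ r a b, Constraint.rel r a b ∈ S' ↔ Constraint.rel r a b ∈ S) ∧
  (∀ a ψ, Constraint.sat a ψ ∈ S' → Constraint.sat a ψ ∈ S ∨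
    (a = x ∧ ∃ χ, Constraint.sat x χ ∈ S ∧ ψ ∈ χ.sub)) ∧
  (andApplicable S x ∨ orApplicable S x)

/-- description of a generating step -/
def GenStep (S S' : Finset Constraint) (x r n : ℕ) (ψ : GFormula) (y : ℕ)
    (f : GFormula → GFormula) : Prop :=
  Constraint.sat x (.ge r n ψ) ∈ S ∧ countS S r x ψ < n ∧
  ¬ andApplicable S x ∧ ¬ orApplicable S x ∧ freshIn y S ∧
  (∀ ψ', f ψ' = ψ' ∨ f ψ' = ψ'.nnfNeg) ∧
  (∀ s a b, Constraint.rel s a b ∈ S' ↔ Constraint.rel s a b ∈ S ∨ (s = r ∧ a = x ∧ b = y)) ∧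
  (∀ a χ, Constraint.sat a χ ∈ S' ↔ Constraint.sat a χ ∈ S ∨ (a = y ∧ (χ = ψ ∨
    ∃ ψ' m, (Constraint.sat x (.ge r m ψ') ∈ S ∨ Constraint.sat x (.le r m ψ') ∈ S) ∧
      χ = f ψ')))

lemma step_cases {S S' : Finset Constraint} (h : OptStep S S') :
    S ⊂ S' ∧ ((∃ x, LocalStep S S' x) ∨ ∃ x r n ψ y f, GenStep S S' x r n ψ y f) := by
  rcases h with h | h | h
  · obtain ⟨x, ψ₁, ψ₂, h, h2⟩ := h
    constructor
    · rw [Finset.ssubset_iff_subset_ne]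
      refine ⟨fun c hc => by simp [hc], fun he => h2 ?_⟩
      rw [he]; simp
    · refine Or.inl ⟨x, ?_, ?_, Or.inl ⟨ψ₁, ψ₂, h, h2⟩⟩
      · simp
      · intro a ψ ha
        simp only [Finset.mem_insert, Constraint.sat.injEq] at ha
        rcases ha with ⟨rfl, rfl⟩ | ⟨rfl, rfl⟩ | ha
        · exact Or.inr ⟨rfl, _, h, by simp [GFormula.sub, mem_sub_self]⟩
        · exact Or.inr ⟨rfl, _, h, by simp [GFormula.sub, mem_sub_self]⟩
        · exact Or.inl ha
  · obtain ⟨x, ψ₁, ψ₂, χ, h, h1, h2, hχ⟩ := h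
    constructor
    · rw [Finset.ssubset_iff_subset_ne]
      refine ⟨fun c hc => by simp [hc], fun he => ?_⟩
      have : Constraint.sat x χ ∈ S := by rw [he]; simp
      rcases hχ with rfl | rfl <;> contradiction
    · refine Or.inl ⟨x, ?_, ?_, Or.inr ⟨ψ₁, ψ₂, h, h1, h2⟩⟩
      · simp
      · intro a ψ ha
        simp only [Finset.mem_insert, Constraint.sat.injEq] at ha
        rcases ha with ⟨rfl, rfl⟩ | ha
        · refine Or.inr ⟨rfl, _, h, ?_⟩
          rcases hχ with rfl | rfl <;> simp [GFormula.sub, mem_sub_self]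
        · exact Or.inl ha
  · obtain ⟨x, r, n, ψ, y, f, h, hc, hna, hno, hy, hf, hS'⟩ := h
    have hm : ∀ c, c ∈ S' ↔ (c ∈ S ∨ c = Constraint.rel r x y ∨ c = Constraint.sat y ψ) ∨
        ∃ ψ' m, (Constraint.sat x (.ge r m ψ') ∈ S ∨ Constraint.sat x (.le r m ψ') ∈ S) ∧
            c = Constraint.sat y (f ψ') := by
      intro c
      rw [← Finset.mem_coe, hS']
      simp only [Set.mem_union, Finset.mem_coe, Set.mem_insert_iff, Set.mem_singleton_iff,
        Set.mem_ofPred_eq]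
    constructor
    · rw [Finset.ssubset_iff_subset_ne]
      refine ⟨fun c hc => by rw [hm]; simp [hc], fun he => ?_⟩
      have : Constraint.rel r x y ∈ S := by rw [he, hm]; simp
      exact hy _ this (by simp [Constraint.vars])
    · refine Or.inr ⟨x, r, n, ψ, y, f, h, hc, hna, hno, hy, hf, ?_, ?_⟩
      · intro s a b
        rw [hm]; simp
      · intro a χ
        rw [hm]; simp only [Constraint.sat.injEq, reduceCtorEq, false_or]
        constructor
        · rintro ((h | ⟨rfl, rfl⟩) | ⟨ψ', m, h1, rfl, rfl⟩)
          · exact Or.inl h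
          · exact Or.inr ⟨rfl, Or.inl rfl⟩
          · exact Or.inr ⟨rfl, Or.inr ⟨ψ', m, h1, rfl⟩⟩
        · rintro (h | ⟨rfl, (rfl | ⟨ψ', m, h1, rfl⟩)⟩)
          · exact Or.inl (Or.inl h)
          · exact Or.inl (Or.inr ⟨rfl, rfl⟩)
          · exact Or.inr ⟨ψ', m, h1, rfl, rfl⟩

lemma exists_fresh (S : Finset Constraint) : ∃ y, freshIn y S := by
  obtain ⟨y, hy⟩ := Infinite.exists_notMem_finset (S.biUnion Constraint.vars)
  exact ⟨y, fun c hc hyc => hy (Finset.mem_biUnion.2 ⟨c, hc, hyc⟩)⟩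

lemma fresh_sat {y : ℕ} {S : Finset Constraint} (h : freshIn y S) {ψ} :
    Constraint.sat y ψ ∉ S := fun hc => h _ hc (by simp [Constraint.vars])
lemma fresh_rel1 {y : ℕ} {S : Finset Constraint} (h : freshIn y S) {r z} :
    Constraint.rel r y z ∉ S := fun hc => h _ hc (by simp [Constraint.vars])
lemma fresh_rel2 {y : ℕ} {S : Finset Constraint} (h : freshIn y S) {r z} :
    Constraint.rel r z y ∉ S := fun hc => h _ hc (by simp [Constraint.vars])

lemma exists_gen {S : Finset Constraint} {x r n : ℕ} {ψ : GFormula}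
    (h : Constraint.sat x (.ge r n ψ) ∈ S) (hc : countS S r x ψ < n)
    (hna : ¬ andApplicable S x) (hno : ¬ orApplicable S x)
    (f : GFormula → GFormula) (hf : ∀ ψ', f ψ' = ψ' ∨ f ψ' = ψ'.nnfNeg)
    (y : ℕ) (hy : freshIn y S) :
    ∃ S', OptStep S S' ∧ GenStep S S' x r n ψ y f := by
  have hfin : ((S : Set Constraint) ∪ {Constraint.rel r x y, Constraint.sat y ψ} ∪
          {c | ∃ ψ' m,
            (Constraint.sat x (.ge r m ψ') ∈ S ∨ Constraint.sat x (.le r m ψ') ∈ S) ∧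
            c = Constraint.sat y (f ψ')}).Finite := by
    refine ((Finset.finite_toSet S).union (by simp)).union ?_
    let g : Constraint → Constraint := fun c => match c with
      | .sat _ (.ge _ _ ψ') => .sat y (f ψ')
      | .sat _ (.le _ _ ψ') => .sat y (f ψ')
      | c => c
    refine ((Finset.finite_toSet S).image g).subset ?_
    rintro c ⟨ψ', m, h | h, rfl⟩
    · exact ⟨_, h, rfl⟩
    · exact ⟨_, h, rfl⟩
  have hst : StepGe S hfin.toFinset :=
    StepGe.mk S _ x r n ψ y f h hc hna hno hy hf (by simp)
  refine ⟨hfin.toFinset, Or.inr (Or.inr hst), h, hc, hna, hno, hy, hf, ?_, ?_⟩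
  · intro s a b
    simp [or_comm]
  · intro a χ
    simp only [Set.Finite.mem_toFinset, Set.mem_union, Finset.mem_coe, Set.mem_insert_iff,
      Set.mem_singleton_iff, Set.mem_ofPred_eq, Constraint.sat.injEq, reduceCtorEq, false_or]
    constructor
    · rintro ((h | ⟨rfl, rfl⟩) | ⟨ψ', m, h1, rfl, rfl⟩)
      · exact Or.inl h
      · exact Or.inr ⟨rfl, Or.inl rfl⟩
      · exact Or.inr ⟨rfl, Or.inr ⟨ψ', m, h1, rfl⟩⟩
    · rintro (h | ⟨rfl, (rfl | ⟨ψ', m, h1, rfl⟩)⟩)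
      · exact Or.inl (Or.inl h)
      · exact Or.inl (Or.inr ⟨rfl, rfl⟩)
      · exact Or.inr ⟨ψ', m, h1, rfl, rfl⟩

lemma finite_succ (S : Finset Constraint) (r x : ℕ) (ψ : GFormula) :
    {y : ℕ | Constraint.rel r x y ∈ S ∧ Constraint.sat y ψ ∈ S}.Finite := by
  refine Set.Finite.subset (Finset.finite_toSet (S.biUnion Constraint.vars)) ?_
  rintro y ⟨h, -⟩
  simp only [Finset.mem_coe, Finset.mem_biUnion]
  exact ⟨_, h, by simp [Constraint.vars]⟩

lemma countS_mono {S S' : Finset Constraint} (h : S ⊆ S') (r x : ℕ) (ψ : GFormula) :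
    countS S r x ψ ≤ countS S' r x ψ :=
  Set.ncard_le_ncard (fun _ hy => ⟨h hy.1, h hy.2⟩) (finite_succ _ _ _ _)

/-! ### Invariants -/

/-- choice invariant -/
def Ginv (S : Finset Constraint) : Prop :=
  ∀ r x y, Constraint.rel r x y ∈ S → ¬ andApplicable S x ∧ ¬ orApplicable S x ∧
    ∀ ψ m, (Constraint.sat x (.ge r m ψ) ∈ S ∨ Constraint.sat x (.le r m ψ) ∈ S) →
      Constraint.sat y ψ ∈ S ∨ Constraint.sat y ψ.nnfNeg ∈ S

lemma Ginv_init (x₀ φ) : Ginv (initCS x₀ φ) := by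
  intro r x y h; simp [initCS] at h

lemma app_congr {S S' : Finset Constraint} {x : ℕ}
    (h : ∀ ψ, Constraint.sat x ψ ∈ S' ↔ Constraint.sat x ψ ∈ S) :
    (andApplicable S' x ↔ andApplicable S x) ∧ (orApplicable S' x ↔ orApplicable S x) := by
  simp only [andApplicable, orApplicable, h, and_self]

lemma Ginv_step {S S' : Finset Constraint} (hG : Ginv S) (h : OptStep S S') : Ginv S' := by
  obtain ⟨hss, h⟩ := step_cases h
  have hsub := hss.subset
  rcases h with ⟨z, h1, h2, h3⟩ | ⟨z, s, n, ψ, w, f, h1, h2, h3, h4, h5, h6, h7, h8⟩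
  · intro r x y hr
    obtain ⟨g1, g2, g3⟩ := hG r x y ((h1 _ _ _).1 hr)
    have hxz : x ≠ z := by rintro rfl; tauto
    have hx : ∀ ψ, Constraint.sat x ψ ∈ S' ↔ Constraint.sat x ψ ∈ S :=
      fun ψ => ⟨fun hh => by rcases h2 _ _ hh with h | h; exacts [h, absurd h.1 hxz],
        fun hh => hsub hh⟩
    obtain ⟨e1, e2⟩ := app_congr hx
    rw [e1, e2]
    refine ⟨g1, g2, fun ψ m hh => ?_⟩
    rw [hx, hx] at hh
    exact (g3 ψ m hh).imp (fun h => hsub h) (fun h => hsub h)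
  · intro r x y hr
    have key : x ≠ w → ∀ ψ, Constraint.sat x ψ ∈ S' ↔ Constraint.sat x ψ ∈ S := by
      intro hxw ψ; rw [h8]; simp [hxw]
    rcases (h7 _ _ _).1 hr with hr | ⟨rfl, rfl, rfl⟩
    · have hxw : x ≠ w := by rintro rfl; exact fresh_rel1 h5 hr
      obtain ⟨g1, g2, g3⟩ := hG r x y hr
      obtain ⟨e1, e2⟩ := app_congr (key hxw)
      rw [e1, e2]
      refine ⟨g1, g2, fun ψ m hh => ?_⟩
      rw [key hxw, key hxw] at hh
      exact (g3 ψ m hh).imp (fun h => hsub h) (fun h => hsub h)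
    · have hxw : x ≠ y := by rintro rfl; exact fresh_sat h5 h1
      obtain ⟨e1, e2⟩ := app_congr (key hxw)
      rw [e1, e2]
      refine ⟨h3, h4, fun χ m hh => ?_⟩
      rw [key hxw, key hxw] at hh
      have : Constraint.sat y (f χ) ∈ S' := (h8 _ _).2 (Or.inr ⟨rfl, Or.inr ⟨χ, m, hh, rfl⟩⟩)
      rcases h6 χ with e | e <;> rw [e] at this
      · exact Or.inl this
      · exact Or.inr this

lemma Ginv_reach {x₀ φ S} (h : OptReach x₀ φ S) : Ginv S := by
  induction h with
  | refl => exact Ginv_init _ _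
  | tail _ h ih => exact Ginv_step ih h

/-! ### Soundness -/

lemma mk_countS (S : Finset Constraint) (r x : ℕ) (ψ : GFormula) :
    Cardinal.mk {y : ℕ // Constraint.rel r x y ∈ S ∧ Constraint.sat y ψ ∈ S} =
      (countS S r x ψ : Cardinal) := by
  rw [countS, Set.cast_ncard (finite_succ S r x ψ)]
  rfl

lemma soundness {S : Finset Constraint} (hG : Ginv S) (hc : OptComplete S) (hn : ¬ hasClash S)
    (ψ : GFormula) (hψ : ψ.isNNF) :
    (∀ x : ℕ, Constraint.sat x ψ ∈ S → GFormula.sat (canonical S) ψ x) ∧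
    (∀ x : ℕ, Constraint.sat x ψ.nnfNeg ∈ S → ¬ GFormula.sat (canonical S) ψ x) := by
  have hand : ∀ x a b, Constraint.sat x (.and a b) ∈ S →
      Constraint.sat x a ∈ S ∧ Constraint.sat x b ∈ S := by
    intro x a b h
    by_contra h2
    exact hc ⟨_, Or.inl (StepAnd.mk S x a b h h2)⟩
  have hor : ∀ x a b, Constraint.sat x (.or a b) ∈ S →
      Constraint.sat x a ∈ S ∨ Constraint.sat x b ∈ S := by
    intro x a b h
    by_contra! h2
    exact hc ⟨_, Or.inr (Or.inl (StepOr.mk S x a b a h h2.1 h2.2 (Or.inl rfl)))⟩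
  have hge : ∀ (r n : ℕ) (χ : GFormula),
      (∀ x : ℕ, Constraint.sat x χ ∈ S → GFormula.sat (canonical S) χ x) →
      ∀ x : ℕ, Constraint.sat x (.ge r n χ) ∈ S →
        GFormula.sat (canonical S) (.ge r n χ) x := by
    intro r n χ ih x hx
    have h1 : n ≤ countS S r x χ := by
      by_contra! hlt
      obtain ⟨y, hy⟩ := exists_fresh S
      have hna : ¬ andApplicable S x := by
        rintro ⟨a, b, h, h'⟩; exact h' (hand _ _ _ h)
      have hno : ¬ orApplicable S x := by
        rintro ⟨a, b, h, h', h''⟩; have := hor _ _ _ h; tauto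
      obtain ⟨S', h, -⟩ := exists_gen hx hlt hna hno id (fun _ => Or.inl rfl) y hy
      exact hc ⟨_, h⟩
    change (n : Cardinal) ≤ Cardinal.mk
      {y : ℕ // Constraint.rel r x y ∈ S ∧ GFormula.sat (canonical S) χ y}
    calc (n : Cardinal) ≤ (countS S r x χ : Cardinal) := by exact_mod_cast h1
      _ = _ := (mk_countS _ _ _ _).symm
      _ ≤ _ := Cardinal.mk_subtype_mono (fun y hy => ⟨hy.1, ih y hy.2⟩)
  have hle : ∀ (r n : ℕ) (χ : GFormula),
      (∀ x : ℕ, Constraint.sat x χ.nnfNeg ∈ S → ¬ GFormula.sat (canonical S) χ x) →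
      ∀ x : ℕ, Constraint.sat x (.le r n χ) ∈ S →
        GFormula.sat (canonical S) (.le r n χ) x := by
    intro r n χ ih x hx
    have h1 : countS S r x χ ≤ n := by
      by_contra! hlt
      exact hn (Or.inr ⟨x, r, n, χ, hx, hlt⟩)
    change Cardinal.mk
      {y : ℕ // Constraint.rel r x y ∈ S ∧ GFormula.sat (canonical S) χ y} ≤ (n : Cardinal)
    calc _ ≤ Cardinal.mk {y : ℕ // Constraint.rel r x y ∈ S ∧ Constraint.sat y χ ∈ S} := by
            refine Cardinal.mk_subtype_mono (fun y hy => ⟨hy.1, ?_⟩)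
            rcases (hG r x y hy.1).2.2 χ n (Or.inr hx) with h | h
            · exact h
            · exact absurd hy.2 (ih y h)
      _ = (countS S r x χ : Cardinal) := mk_countS _ _ _ _
      _ ≤ _ := by exact_mod_cast h1
  have hat : ∀ x p, Constraint.sat x (.neg (.atom p)) ∈ S →
      ¬ GFormula.sat (canonical S) (.atom p) x := by
    intro x p h h'
    exact hn (Or.inl ⟨x, p, h', h⟩)
  induction ψ with
  | atom p => exact ⟨fun x h => h, fun x h => hat x p h⟩
  | neg χ ih =>
    cases χ with
    | atom p => exact ⟨fun x h => hat x p h, fun x h h' => h' h⟩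
    | _ => exact absurd hψ (by simp [GFormula.isNNF])
  | and a b iha ihb =>
    have iha := iha hψ.1
    have ihb := ihb hψ.2
    refine ⟨fun x h => ?_, fun x h h' => ?_⟩
    · have := hand _ _ _ h
      exact ⟨iha.1 _ this.1, ihb.1 _ this.2⟩
    · rcases hor _ _ _ h with h | h
      · exact iha.2 _ h h'.1
      · exact ihb.2 _ h h'.2
  | or a b iha ihb =>
    have iha := iha hψ.1
    have ihb := ihb hψ.2
    refine ⟨fun x h => ?_, fun x h h' => ?_⟩
    · rcases hor _ _ _ h with h | h
      · exact Or.inl (iha.1 _ h)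
      · exact Or.inr (ihb.1 _ h)
    · have := hand _ _ _ h
      rcases h' with h' | h'
      · exact iha.2 _ this.1 h'
      · exact ihb.2 _ this.2 h'
  | ge r n χ ih =>
    have ih := ih hψ
    refine ⟨fun x h => hge r n χ ih.1 x h, fun x h => ?_⟩
    refine (sat_nnfNeg (canonical S) _ x).1 ?_
    simp only [GFormula.nnfNeg] at h ⊢
    split_ifs at h ⊢ with h0
    · have := hand _ _ _ h
      exact absurd this.1 (hat x 0 this.2)
    · exact hle _ _ _ ih.2 x h
  | le r n χ ih =>
    have ih := ih hψ
    refine ⟨fun x h => hle r n χ ih.2 x h, fun x h => ?_⟩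
    refine (sat_nnfNeg (canonical S) _ x).1 ?_
    exact hge _ _ _ ih.1 x h

/-! ### Completeness -/

lemma csSat_noClash {S : Finset Constraint} (h : csSat S) : ¬ hasClash S := by
  obtain ⟨M, α, h1, h2, h3⟩ := h
  rintro (⟨x, p, a, b⟩ | ⟨x, r, n, ψ, a, b⟩)
  · exact h2 _ _ b (h2 _ _ a)
  · have h := h2 _ _ a
    simp only [GFormula.sat] at h
    have : (countS S r x ψ : Cardinal) ≤ (n : Cardinal) := by
      refine le_trans ?_ h
      rw [← mk_countS]
      refine Cardinal.mk_le_of_injective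
        (f := fun y => ⟨α y.1, h3 _ _ _ y.2.1, h2 _ _ y.2.2⟩) ?_
      rintro ⟨y, hy⟩ ⟨z, hz⟩ hyz
      by_contra hne
      exact h1 r x y z hy.1 hz.1 (fun e => hne (Subtype.ext e)) (congrArg Subtype.val hyz)
    have : countS S r x ψ ≤ n := by exact_mod_cast this
    omega

lemma csSat_step {S : Finset Constraint} (hG : Ginv S) (h : csSat S) (hnc : ¬ OptComplete S) :
    ∃ S', OptStep S S' ∧ csSat S' := by
  classical
  obtain ⟨M, α, h1, h2, h3⟩ := h
  obtain ⟨S', hS⟩ := not_not.1 hnc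
  rcases hS with hS | hS | hS
  · refine ⟨S', Or.inl hS, M, α, ?_⟩
    obtain ⟨x, a, b, h, h'⟩ := hS
    have := h2 _ _ h
    simp only [Finset.mem_insert, reduceCtorEq, false_or, Constraint.sat.injEq]
    refine ⟨h1, ?_, h3⟩
    rintro y ψ (⟨rfl, rfl⟩ | ⟨rfl, rfl⟩ | h)
    exacts [this.1, this.2, h2 _ _ h]
  · obtain ⟨x, a, b, -, h, ha, hb, -⟩ := hS
    have : ∃ χ, (χ = a ∨ χ = b) ∧ GFormula.sat M χ (α x) := by
      rcases h2 _ _ h with h | h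
      · exact ⟨a, Or.inl rfl, h⟩
      · exact ⟨b, Or.inr rfl, h⟩
    obtain ⟨χ, hχ, hs⟩ := this
    refine ⟨_, Or.inr (Or.inl (StepOr.mk S x a b χ h ha hb hχ)), M, α, ?_⟩
    simp only [Finset.mem_insert, reduceCtorEq, false_or, Constraint.sat.injEq]
    refine ⟨h1, ?_, h3⟩
    rintro y ψ (⟨rfl, rfl⟩ | h)
    exacts [hs, h2 _ _ h]
  · obtain ⟨x, r, n, ψ, y, -, h, hc, hna, hno, hy, -, -⟩ := hS
    have hx := h2 _ _ h
    -- a witness not yet used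
    have : ∃ w, M.rel r (α x) w ∧ GFormula.sat M ψ w ∧
        ∀ z, Constraint.rel r x z ∈ S → α z ≠ w := by
      by_contra! hcon
      have hsub : {w | M.rel r (α x) w ∧ GFormula.sat M ψ w} ⊆
          α '' {z | Constraint.rel r x z ∈ S ∧ Constraint.sat z ψ ∈ S} := by
        rintro w ⟨hw1, hw2⟩
        obtain ⟨z, hz, rfl⟩ := hcon w hw1 hw2
        refine ⟨z, ⟨hz, ?_⟩, rfl⟩
        rcases (hG r x z hz).2.2 ψ n (Or.inl h) with h' | h'
        · exact h'
        · exact absurd hw2 ((sat_nnfNeg _ _ _).1 (h2 _ _ h'))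
      have l1 := Cardinal.mk_le_mk_of_subset hsub
      have l2 : Cardinal.mk (α '' {z | Constraint.rel r x z ∈ S ∧ Constraint.sat z ψ ∈ S}) ≤
        (countS S r x ψ : Cardinal) := by
        rw [← mk_countS]
        exact Cardinal.mk_image_le (f := α)
          (s := {z | Constraint.rel r x z ∈ S ∧ Constraint.sat z ψ ∈ S})
      have l3 : (n : Cardinal) ≤ (countS S r x ψ : Cardinal) := le_trans hx (l1.trans l2)
      have : n ≤ countS S r x ψ := by exact_mod_cast l3
      omega
    obtain ⟨w, hw1, hw2, hw3⟩ := this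
    let f : GFormula → GFormula := fun χ => if GFormula.sat M χ w then χ else χ.nnfNeg
    have hfs : ∀ χ, GFormula.sat M (f χ) w := by
      intro χ
      by_cases hh : GFormula.sat M χ w
      · simp [f, hh]
      · simp [f, hh, sat_nnfNeg]
    obtain ⟨S', hst, -, -, -, -, -, -, g7, g8⟩ := exists_gen h hc hna hno f
      (fun χ => by by_cases hh : GFormula.sat M χ w <;> simp [f, hh]) y hy
    have hxy : x ≠ y := by rintro rfl; exact fresh_sat hy h
    refine ⟨S', hst, M, Function.update α y w, ?_, ?_, ?_⟩
    · intro s a b c hb hc' hbc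
      rw [g7] at hb hc'
      rcases hb with hb | ⟨rfl, rfl, rfl⟩ <;> rcases hc' with hc' | ⟨h5, h6, h7⟩
      · have e1 : b ≠ y := by rintro rfl; exact fresh_rel2 hy hb
        have e2 : c ≠ y := by rintro rfl; exact fresh_rel2 hy hc'
        rw [Function.update_of_ne e1, Function.update_of_ne e2]
        exact h1 _ _ _ _ hb hc' hbc
      · subst h5 h6 h7
        have e1 : b ≠ c := by rintro rfl; exact fresh_rel2 hy hb
        rw [Function.update_of_ne e1, Function.update_self]
        exact hw3 _ hb
      · have e1 : c ≠ b := by rintro rfl; exact fresh_rel2 hy hc'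
        rw [Function.update_of_ne e1, Function.update_self]
        exact (hw3 _ hc').symm
      · exact absurd h7.symm hbc
    · intro a χ ha
      rw [g8] at ha
      rcases ha with ha | ⟨rfl, rfl | ⟨ψ', m, -, rfl⟩⟩
      · have e1 : a ≠ y := by rintro rfl; exact fresh_sat hy ha
        rw [Function.update_of_ne e1]; exact h2 _ _ ha
      · rw [Function.update_self]; exact hw2
      · rw [Function.update_self]; exact hfs _
    · intro s a b hb
      rw [g7] at hb
      rcases hb with hb | ⟨rfl, rfl, rfl⟩
      · have e1 : b ≠ y := by rintro rfl; exact fresh_rel2 hy hb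
        have e2 : a ≠ y := by rintro rfl; exact fresh_rel1 hy hb
        rw [Function.update_of_ne e1, Function.update_of_ne e2]; exact h3 _ _ _ hb
      · rw [Function.update_self, Function.update_of_ne hxy]; exact hw1

/-! ### Termination -/

/-- structural invariant -/
structure Tinv (x₀ : ℕ) (S : Finset Constraint) : Prop where
  depth : ∀ r x y, Constraint.rel r x y ∈ S → ∀ ψ, Constraint.sat y ψ ∈ S →
    ∃ χ, Constraint.sat x χ ∈ S ∧ ψ.md < χ.md
  label : ∀ r x y, Constraint.rel r x y ∈ S → ∃ ψ, Constraint.sat y ψ ∈ S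
  conn : ∀ x ψ, Constraint.sat x ψ ∈ S → Relation.ReflTransGen (edge S) x₀ x

lemma Tinv_init (x₀ φ) : Tinv x₀ (initCS x₀ φ) := by
  constructor
  · intro r x y h; simp [initCS] at h
  · intro r x y h; simp [initCS] at h
  · intro x ψ h
    simp only [initCS, Finset.mem_singleton, Constraint.sat.injEq] at h
    rw [h.1]

lemma Tinv_step {x₀} {S S' : Finset Constraint} (hT : Tinv x₀ S) (h : OptStep S S') :
    Tinv x₀ S' := by
  obtain ⟨hss, h⟩ := step_cases h
  have hsub := hss.subset
  have hmono : ∀ x, Relation.ReflTransGen (edge S) x₀ x →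
      Relation.ReflTransGen (edge S') x₀ x := fun x hx =>
    Relation.ReflTransGen.mono (fun a b ⟨r, hr⟩ => ⟨r, hsub hr⟩) x₀ x hx
  rcases h with ⟨z, h1, h2, h3⟩ | ⟨z, s, n, ψ, w, f, h1, h2, h3, h4, h5, h6, h7, h8⟩
  · constructor
    · intro r x y hr ψ hψ
      rw [h1] at hr
      rcases h2 _ _ hψ with hψ | ⟨rfl, χ, hχ, hs⟩
      · obtain ⟨χ, a, b⟩ := hT.depth _ _ _ hr _ hψ
        exact ⟨χ, hsub a, b⟩
      · obtain ⟨χ', a, b⟩ := hT.depth _ _ _ hr _ hχ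
        exact ⟨χ', hsub a, lt_of_le_of_lt (md_sub hs) b⟩
    · intro r x y hr
      rw [h1] at hr
      obtain ⟨ψ, h⟩ := hT.label _ _ _ hr
      exact ⟨ψ, hsub h⟩
    · intro x ψ hψ
      rcases h2 _ _ hψ with hψ | ⟨rfl, χ, hχ, hs⟩
      · exact hmono _ (hT.conn _ _ hψ)
      · exact hmono _ (hT.conn _ _ hχ)
  · constructor
    · intro r x y hr χ hχ
      rcases (h7 _ _ _).1 hr with hr | ⟨rfl, rfl, rfl⟩
      · have e : y ≠ w := by rintro rfl; exact fresh_rel2 h5 hr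
        rw [h8] at hχ
        rcases hχ with hχ | hχ
        · obtain ⟨χ', a, b⟩ := hT.depth _ _ _ hr _ hχ
          exact ⟨χ', hsub a, b⟩
        · exact absurd hχ.1 e
      · rw [h8] at hχ
        rcases hχ with hχ | ⟨-, rfl | ⟨ψ', m, hm, rfl⟩⟩
        · exact absurd hχ (fresh_sat h5)
        · exact ⟨_, hsub h1, by simp [GFormula.md]⟩
        · have : (f ψ').md ≤ ψ'.md := by
            rcases h6 ψ' with e | e <;> rw [e]
            exact md_nnfNeg _
          rcases hm with hm | hm
          · exact ⟨_, hsub hm, by simp only [GFormula.md]; omega⟩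
          · exact ⟨_, hsub hm, by simp only [GFormula.md]; omega⟩
    · intro r x y hr
      rcases (h7 _ _ _).1 hr with hr | ⟨rfl, rfl, rfl⟩
      · obtain ⟨ψ, h⟩ := hT.label _ _ _ hr
        exact ⟨ψ, hsub h⟩
      · exact ⟨ψ, (h8 _ _).2 (Or.inr ⟨rfl, Or.inl rfl⟩)⟩
    · intro x χ hχ
      rcases (h8 _ _).1 hχ with hχ | ⟨rfl, -⟩
      · exact hmono _ (hT.conn _ _ hχ)
      · exact (hmono _ (hT.conn _ _ h1)).tail ⟨s, (h7 _ _ _).2 (Or.inr ⟨rfl, rfl, rfl⟩)⟩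

lemma label_step {S S' : Finset Constraint} (h : OptStep S S') {x : ℕ} {χ : GFormula}
    (hx : Constraint.sat x χ ∈ S) {ψ} (hψ : Constraint.sat x ψ ∈ S') :
    ∃ χ, Constraint.sat x χ ∈ S ∧ ψ ∈ χ.sub := by
  obtain ⟨hss, h⟩ := step_cases h
  rcases h with ⟨z, h1, h2, h3⟩ | ⟨z, s, n, ψ', w, f, h1, h2, h3, h4, h5, h6, h7, h8⟩
  · rcases h2 _ _ hψ with hψ | ⟨rfl, h⟩
    · exact ⟨ψ, hψ, mem_sub_self _⟩
    · exact h
  · rcases (h8 _ _).1 hψ with hψ | ⟨rfl, -⟩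
    · exact ⟨ψ, hψ, mem_sub_self _⟩
    · exact absurd hx (fresh_sat h5)

lemma rel_step {S S' : Finset Constraint} (h : OptStep S S') {r x y : ℕ}
    (hn : Constraint.rel r x y ∉ S) (hx : Constraint.rel r x y ∈ S') :
    ∃ n ψ, Constraint.sat x (.ge r n ψ) ∈ S ∧ countS S r x ψ < n ∧
      countS S r x ψ < countS S' r x ψ := by
  obtain ⟨hss, h⟩ := step_cases h
  rcases h with ⟨z, h1, h2, h3⟩ | ⟨z, s, n, ψ', w, f, h1, h2, h3, h4, h5, h6, h7, h8⟩
  · exact absurd ((h1 _ _ _).1 hx) hn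
  · rcases (h7 _ _ _).1 hx with hx' | ⟨rfl, rfl, rfl⟩
    · exact absurd hx' hn
    · refine ⟨n, ψ', h1, h2, Set.ncard_lt_ncard ?_ (finite_succ _ _ _ _)⟩
      have hs : {y : ℕ | Constraint.rel r x y ∈ S ∧ Constraint.sat y ψ' ∈ S} ⊆
          {y : ℕ | Constraint.rel r x y ∈ S' ∧ Constraint.sat y ψ' ∈ S'} :=
        fun _ hy => ⟨hss.subset hy.1, hss.subset hy.2⟩
      rw [Set.ssubset_iff_of_subset hs]
      exact ⟨y, ⟨hx, (h8 _ _).2 (Or.inr ⟨rfl, Or.inl rfl⟩)⟩, fun hh => hn hh.1⟩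

lemma termination (φ : GFormula) (x₀ : ℕ) : ¬ ∃ f : ℕ → Finset Constraint,
    f 0 = initCS x₀ φ ∧ ∀ n, OptStep (f n) (f (n + 1)) := by
  rintro ⟨f, hf0, hf⟩
  have hsm : StrictMono f := strictMono_nat_of_lt_succ (fun n => (step_cases (hf n)).1)
  have hmono : ∀ {m n}, m ≤ n → f m ⊆ f n := fun h => hsm.monotone h
  have hT : ∀ n, Tinv x₀ (f n) := by
    intro n
    induction n with
    | zero => rw [hf0]; exact Tinv_init _ _
    | succ n ih => exact Tinv_step ih (hf n)
  let U : Set Constraint := {c | ∃ n, c ∈ f n}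
  -- labels are finite
  have hlab : ∀ x : ℕ, {ψ | Constraint.sat x ψ ∈ U}.Finite := by
    intro x
    by_cases hx : ∃ χ, Constraint.sat x χ ∈ U
    swap
    · convert Set.finite_empty (α := GFormula)
      ext ψ
      simp only [Set.mem_ofPred_eq, Set.mem_empty_iff_false, iff_false]
      exact fun h => hx ⟨ψ, h⟩
    obtain ⟨χ₀, k, hk⟩ := hx
    have hall : ∀ j, ∀ ψ, Constraint.sat x ψ ∈ f (k + j) →
        ∃ χ, Constraint.sat x χ ∈ f k ∧ ψ ∈ χ.sub := by
      intro j
      induction j with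
      | zero => exact fun ψ h => ⟨ψ, h, mem_sub_self _⟩
      | succ j ih =>
        intro ψ hψ
        obtain ⟨χ, h1, h2⟩ := label_step (hf (k + j)) (hmono (by omega) hk) hψ
        obtain ⟨χ', h3, h4⟩ := ih χ h1
        exact ⟨χ', h3, sub_trans h2 h4⟩
    let g : Constraint → Set GFormula := fun c => match c with
      | .sat _ χ => χ.sub
      | _ => ∅
    have hg : (⋃ c ∈ (f k : Set Constraint), g c).Finite := by
      refine (Finset.finite_toSet (f k)).biUnion (fun c _ => ?_)
      cases c with
      | sat a χ => exact Finset.finite_toSet χ.sub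
      | rel => exact Set.finite_empty
    refine hg.subset ?_
    rintro ψ ⟨m, hm⟩
    obtain ⟨χ, h1, h2⟩ := hall m ψ (hmono (by omega) hm)
    simp only [Set.mem_iUnion]
    exact ⟨_, h1, h2⟩
  -- outgoing edges are finite
  have hout : ∀ x : ℕ, {c ∈ U | ∃ r y, c = Constraint.rel r x y}.Finite := by
    intro x
    let K : GFormula → Set ℕ := fun χ => match χ with
      | .ge r n ψ => {k | countS (f k) r x ψ < n ∧ countS (f k) r x ψ < countS (f (k+1)) r x ψ}
      | _ => ∅
    have hK : ∀ χ, (K χ).Finite := by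
      intro χ
      cases χ with
      | ge r n ψ =>
        have hmaps : Set.MapsTo (fun k => countS (f k) r x ψ) (K (.ge r n ψ)) (Set.Iio n) :=
          fun k hk => hk.1
        refine Set.Finite.of_injOn hmaps ?_ (Set.finite_Iio n)
        have hlt : ∀ a ∈ K (.ge r n ψ), ∀ b, a < b →
            countS (f a) r x ψ < countS (f b) r x ψ := fun a ha b hab =>
          lt_of_lt_of_le ha.2 (countS_mono (hmono hab) r x ψ)
        intro a ha b hb hab
        simp only at hab
        rcases lt_trichotomy a b with h | h | h
        · have := hlt a ha b h; omega
        · exact h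
        · have := hlt b hb a h; omega
      | _ => exact Set.finite_empty
    have hfin : (⋃ χ ∈ {ψ | Constraint.sat x ψ ∈ U}, ⋃ k ∈ K χ,
        (f (k + 1) : Set Constraint)).Finite :=
      (hlab x).biUnion (fun χ _ => (hK χ).biUnion (fun k _ => Finset.finite_toSet _))
    refine hfin.subset ?_
    rintro c ⟨⟨m, hm⟩, r, y, rfl⟩
    have : ∃ k, Constraint.rel r x y ∉ f k ∧ Constraint.rel r x y ∈ f (k + 1) := by
      by_contra! hcon
      have : ∀ k, Constraint.rel r x y ∉ f k := by
        intro k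
        induction k with
        | zero => rw [hf0]; simp [initCS]
        | succ k ih => exact hcon k ih
      exact this m hm
    obtain ⟨k, hk1, hk2⟩ := this
    obtain ⟨n, ψ, h1, h2, h3⟩ := rel_step (hf k) hk1 hk2
    simp only [Set.mem_iUnion]
    exact ⟨.ge r n ψ, ⟨k, h1⟩, k, ⟨h2, h3⟩, hk2⟩
  -- descendants are finite
  let E : ℕ → ℕ → Prop := fun x y => ∃ r, Constraint.rel r x y ∈ U
  have hsucc : ∀ x, {y | E x y}.Finite := by
    intro x
    let g : Constraint → ℕ := fun c => match c with
      | .rel _ _ y => y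
      | _ => 0
    refine ((hout x).image g).subset ?_
    rintro y ⟨r, hr⟩
    exact ⟨_, ⟨hr, r, y, rfl⟩, rfl⟩
  have hdepth : ∀ x y, E x y → ∀ ψ, Constraint.sat y ψ ∈ U →
      ∃ χ, Constraint.sat x χ ∈ U ∧ ψ.md < χ.md := by
    rintro x y ⟨r, m, hm⟩ ψ ⟨n, hn⟩
    obtain ⟨χ, h1, h2⟩ := (hT (max m n)).depth r x y (hmono (le_max_left _ _) hm) ψ
      (hmono (le_max_right _ _) hn)
    exact ⟨χ, ⟨_, h1⟩, h2⟩
  have hdesc : ∀ d x, (∀ ψ, Constraint.sat x ψ ∈ U → ψ.md < d) →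
      {y | Relation.ReflTransGen E x y}.Finite := by
    intro d
    induction d with
    | zero =>
      intro x hx
      refine (Set.finite_singleton x).subset ?_
      intro y hy
      rcases Relation.ReflTransGen.cases_head hy with rfl | ⟨z, hz, -⟩
      · rfl
      · exfalso
        obtain ⟨r, m, hm⟩ := id hz
        obtain ⟨ψ, hψ⟩ := (hT m).label _ _ _ hm
        obtain ⟨χ, h1, -⟩ := hdepth x z hz ψ ⟨m, hψ⟩
        have := hx χ h1
        omega
    | succ d ih =>
      intro x hx
      refine ((Set.finite_singleton x).union ((hsucc x).biUnion
        (t := fun z => {y | Relation.ReflTransGen E z y}) (fun z hz => ih z ?_))).subset ?_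
      · intro ψ hψ
        obtain ⟨χ, h1, h2⟩ := hdepth x z hz ψ hψ
        have := hx χ h1
        omega
      · intro y hy
        rcases Relation.ReflTransGen.cases_head hy with rfl | ⟨z, hz, hzy⟩
        · exact Or.inl rfl
        · refine Or.inr ?_
          simp only [Set.mem_iUnion]
          exact ⟨z, hz, hzy⟩
  have hV : {y | Relation.ReflTransGen E x₀ y}.Finite := by
    obtain ⟨B, hB⟩ := ((hlab x₀).image GFormula.md).bddAbove
    refine hdesc (B + 1) x₀ (fun ψ hψ => ?_)
    have := hB ⟨ψ, hψ, rfl⟩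
    omega
  have hconn : ∀ x ψ, Constraint.sat x ψ ∈ U → Relation.ReflTransGen E x₀ x := by
    rintro x ψ ⟨n, hn⟩
    exact Relation.ReflTransGen.mono (fun a b ⟨r, hr⟩ => ⟨r, n, hr⟩) x₀ x ((hT n).conn x ψ hn)
  have hU : U.Finite := by
    refine (hV.biUnion (t := fun x => Constraint.sat x '' {ψ | Constraint.sat x ψ ∈ U} ∪
      {c ∈ U | ∃ r y, c = Constraint.rel r x y})
      (fun x _ => ((hlab x).image _).union (hout x))).subset ?_
    intro c hc
    simp only [Set.mem_iUnion]
    cases c with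
    | sat x ψ => exact ⟨x, hconn x ψ hc, Or.inl ⟨ψ, hc, rfl⟩⟩
    | rel r x y =>
      obtain ⟨m, hm⟩ := id hc
      obtain ⟨ψ, hψ⟩ := (hT m).label _ _ _ hm
      obtain ⟨χ, h1, -⟩ := (hT m).depth _ _ _ hm _ hψ
      exact ⟨x, hconn x χ ⟨m, h1⟩, Or.inr ⟨hc, r, y, rfl⟩⟩
  have hcard : StrictMono (fun n => (f n).card) := fun a b h => Finset.card_lt_card (hsm h)
  have h1 := hcard.le_apply (x := hU.toFinset.card + 1)
  have h2 : (f (hU.toFinset.card + 1)).card ≤ hU.toFinset.card :=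
    Finset.card_le_card (fun c hc => by rw [Set.Finite.mem_toFinset]; exact ⟨_, hc⟩)
  omega

lemma completeness (φ : GFormula) (x₀ : ℕ) (h : φ.satisfiable) :
    ∃ S, OptReach x₀ φ S ∧ OptComplete S ∧ ¬ hasClash S := by
  by_contra! hcon
  let P := {S // OptReach x₀ φ S ∧ csSat S}
  have hnext : ∀ s : P, ∃ t : P, OptStep s.1 t.1 := by
    rintro ⟨S, hr, hs⟩
    have hnc : ¬ OptComplete S := fun hc => csSat_noClash hs (hcon S hr hc)
    obtain ⟨S', h1, h2⟩ := csSat_step (Ginv_reach hr) hs hnc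
    exact ⟨⟨S', hr.tail h1, h2⟩, h1⟩
  choose nx hnx using hnext
  have h0 : csSat (initCS x₀ φ) := by
    obtain ⟨M, w, hw⟩ := h
    refine ⟨M, fun _ => w, ?_, ?_, ?_⟩
    · intro r x y z h; simp [initCS] at h
    · intro x ψ h
      simp only [initCS, Finset.mem_singleton, Constraint.sat.injEq] at h
      rw [h.2]; exact hw
    · intro r x y h; simp [initCS] at h
  let s0 : P := ⟨initCS x₀ φ, Relation.ReflTransGen.refl, h0⟩
  refine termination φ x₀ ⟨fun n => (nx^[n] s0).1, rfl, fun n => ?_⟩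
  simp only [Function.iterate_succ_apply']
  exact hnx _

lemma reach_init {x₀ φ S} (h : OptReach x₀ φ S) : Constraint.sat x₀ φ ∈ S := by
  induction h with
  | refl => simp [initCS]
  | tail _ h ih => exact (step_cases h).1.subset ih

end GrK

open GrK in
/-- correctness of the optimised algorithm: φ (in NNF) is
satisfiable iff some sequence of applications of the optimised rules starting
from {x₀ ⊨ φ} yields a complete and clash-free c.s.; moreover every sequence
of rule applications is finite. -/
theorem stmt_14 (φ : GFormula) (hNNF : φ.isNNF) (x₀ : ℕ) :
    (φ.satisfiable ↔ ∃ S, OptReach x₀ φ S ∧ OptComplete S ∧ ¬ hasClash S) ∧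
    ¬ ∃ f : ℕ → Finset Constraint,
        f 0 = initCS x₀ φ ∧ ∀ n, OptStep (f n) (f (n + 1)) := by
  refine ⟨⟨completeness φ x₀, ?_⟩, termination φ x₀⟩
  rintro ⟨S, hr, hc, hn⟩
  exact ⟨canonical S, x₀, (soundness (Ginv_reach hr) hc hn φ hNNF).1 x₀ (reach_init hr)⟩
end

section
/- Soundness of the Gr(K_{R⁻¹∩})-algorithm: let φ be a Gr(K_{R⁻¹∩})-formula in NNF. If the Gr(K_{R⁻¹∩}) completion rules can be applied to {x₀ ⊨ φ} so as to yield a complete and clash-free constraint system S, then φ is satisfiable; indeed the canonical structure M_S satisfies M_S, x₀ ⊨ φ. -/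
/-! Core definitions for Gr(K_{R⁻¹∩}): relations with inverses,
intersections of relations, formulae, semantics, constraint systems with
the ≺ bookkeeping relation, and the Gr(K_{R⁻¹∩}) completion rules. -/

namespace GrK

/-- A Gr(K_{R⁻¹∩})-relation: a relation name or the inverse of one. -/
inductive GRel : Type where
  | name : ℕ → GRel
  | inv : ℕ → GRel
  deriving DecidableEq

/-- The inverse of a Gr(K_{R⁻¹∩})-relation, with (R⁻¹)⁻¹ = R. -/
def GRel.inverse : GRel → GRel
  | .name r => .inv r
  | .inv r => .name r

/-- A (nonempty) intersection ω = R₁ ∩ … ∩ R_k of Gr(K_{R⁻¹∩})-relations. -/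
abbrev RelInter := {ω : Finset GRel // ω.Nonempty}

/-- Gr(K_{R⁻¹∩})-formulae: graded modalities over intersections of
(possibly inverse) relations. -/
inductive GIFormula : Type where
  | atom : ℕ → GIFormula
  | neg  : GIFormula → GIFormula
  | and  : GIFormula → GIFormula → GIFormula
  | or   : GIFormula → GIFormula → GIFormula
  | ge   : RelInter → ℕ → GIFormula → GIFormula
  | le   : RelInter → ℕ → GIFormula → GIFormula

noncomputable instance : DecidableEq GIFormula := Classical.decEq _

/-- Interpretation of a (possibly inverse) relation in a Kripke structure. -/
def GRel.interp (M : Kripke) : GRel → M.W → M.W → Prop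
  | .name r => M.rel r
  | .inv r => fun x y => M.rel r y x

/-- Satisfaction for Gr(K_{R⁻¹∩}): ⟨ω⟩_{≥n}/⟨ω⟩_{≤n} count the
⋂_{R∈ω}R-successors satisfying the formula. -/
def GIFormula.sat (M : Kripke) : GIFormula → M.W → Prop
  | .atom p, x => x ∈ M.val p
  | .neg φ, x => ¬ GIFormula.sat M φ x
  | .and φ ψ, x => GIFormula.sat M φ x ∧ GIFormula.sat M ψ x
  | .or φ ψ, x => GIFormula.sat M φ x ∨ GIFormula.sat M ψ x
  | .ge ω n φ, x => (n : Cardinal) ≤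
      Cardinal.mk {y : M.W // (∀ R ∈ ω.1, GRel.interp M R x y) ∧ GIFormula.sat M φ y}
  | .le ω n φ, x =>
      Cardinal.mk {y : M.W // (∀ R ∈ ω.1, GRel.interp M R x y) ∧ GIFormula.sat M φ y} ≤
        (n : Cardinal)

/-- Satisfiability of a Gr(K_{R⁻¹∩})-formula. -/
def GIFormula.satisfiable (φ : GIFormula) : Prop :=
  ∃ (M : Kripke) (x : M.W), GIFormula.sat M φ x

/-- Negation normal form for Gr(K_{R⁻¹∩}). -/
def GIFormula.isNNF : GIFormula → Prop
  | .atom _ => True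
  | .neg (.atom _) => True
  | .neg _ => False
  | .and φ ψ => GIFormula.isNNF φ ∧ GIFormula.isNNF ψ
  | .or φ ψ => GIFormula.isNNF φ ∧ GIFormula.isNNF ψ
  | .ge _ _ φ => GIFormula.isNNF φ
  | .le _ _ φ => GIFormula.isNNF φ

/-- ~φ for Gr(K_{R⁻¹∩})-formulae in NNF. -/
def GIFormula.nnfNeg : GIFormula → GIFormula
  | .atom p => .neg (.atom p)
  | .neg φ => φ
  | .and φ ψ => .or φ.nnfNeg ψ.nnfNeg
  | .or φ ψ => .and φ.nnfNeg ψ.nnfNeg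
  | .ge ω n φ => if n = 0 then .and (.atom 0) (.neg (.atom 0)) else .le ω (n - 1) φ
  | .le ω n φ => .ge ω (n + 1) φ

/-- Constraints for Gr(K_{R⁻¹∩}): `x ⊨ ψ` or `R x y` for a
(possibly inverse) relation R. -/
inductive IConstraint : Type where
  | sat : ℕ → GIFormula → IConstraint
  | rel : GRel → ℕ → ℕ → IConstraint

noncomputable instance : DecidableEq IConstraint := Classical.decEq _

/-- Variables occurring in a constraint. -/
def IConstraint.vars : IConstraint → Finset ℕ
  | .sat x _ => {x}
  | .rel _ x y => {x, y}

/-- ♯ω^S(x,ψ): the number of variables y with Rxy ∈ S for all R ∈ ω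
and y ⊨ ψ ∈ S. -/
noncomputable def countI (S : Finset IConstraint) (ω : RelInter) (x : ℕ) (ψ : GIFormula) : ℕ :=
  Set.ncard {y : ℕ | (∀ R ∈ ω.1, IConstraint.rel R x y ∈ S) ∧ IConstraint.sat y ψ ∈ S}

/-- A clash for Gr(K_{R⁻¹∩}). -/
def hasClashI (S : Finset IConstraint) : Prop :=
  (∃ x p, IConstraint.sat x (.atom p) ∈ S ∧ IConstraint.sat x (.neg (.atom p)) ∈ S) ∨
  (∃ x ω n ψ, IConstraint.sat x (.le ω n ψ) ∈ S ∧ n < countI S ω x ψ)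

/-- The state of the Gr(K_{R⁻¹∩})-algorithm: a constraint system together with
the bookkeeping relation ≺ (x ≺ y iff y was created by the →≥-rule for x). -/
structure IState where
  cs : Finset IConstraint
  prec : Finset (ℕ × ℕ)

/-- The relation ≺ given by the bookkeeping finset. -/
def precRel (P : Finset (ℕ × ℕ)) : ℕ → ℕ → Prop := fun a b => (a, b) ∈ P

/-- The →∧-rule applies to a constraint for x. -/
def iAndApplicable (S : Finset IConstraint) (x : ℕ) : Prop :=
  ∃ ψ₁ ψ₂, IConstraint.sat x (.and ψ₁ ψ₂) ∈ S ∧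
    ¬ (IConstraint.sat x ψ₁ ∈ S ∧ IConstraint.sat x ψ₂ ∈ S)

/-- The →∨-rule applies to a constraint for x. -/
def iOrApplicable (S : Finset IConstraint) (x : ℕ) : Prop :=
  ∃ ψ₁ ψ₂, IConstraint.sat x (.or ψ₁ ψ₂) ∈ S ∧
    IConstraint.sat x ψ₁ ∉ S ∧ IConstraint.sat x ψ₂ ∉ S

/-- The →choose-rule applies to a constraint for x. -/
def iChooseApplicable (S : Finset IConstraint) (x : ℕ) : Prop :=
  ∃ ω n ψ y, (IConstraint.sat x (.ge ω n ψ) ∈ S ∨ IConstraint.sat x (.le ω n ψ) ∈ S) ∧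
    (∃ R ∈ ω.1, IConstraint.rel R x y ∈ S) ∧
    IConstraint.sat y ψ ∉ S ∧ IConstraint.sat y ψ.nnfNeg ∉ S

/-- One application of a Gr(K_{R⁻¹∩}) completion rule. -/
inductive IStep : IState → IState → Prop
  | and (st : IState) (x : ℕ) (ψ₁ ψ₂ : GIFormula)
      (h : IConstraint.sat x (.and ψ₁ ψ₂) ∈ st.cs)
      (h2 : ¬ (IConstraint.sat x ψ₁ ∈ st.cs ∧ IConstraint.sat x ψ₂ ∈ st.cs)) :
      IStep st ⟨insert (IConstraint.sat x ψ₁) (insert (IConstraint.sat x ψ₂) st.cs), st.prec⟩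
  | or (st : IState) (x : ℕ) (ψ₁ ψ₂ χ : GIFormula)
      (h : IConstraint.sat x (.or ψ₁ ψ₂) ∈ st.cs)
      (h1 : IConstraint.sat x ψ₁ ∉ st.cs) (h2 : IConstraint.sat x ψ₂ ∉ st.cs)
      (hχ : χ = ψ₁ ∨ χ = ψ₂) :
      IStep st ⟨insert (IConstraint.sat x χ) st.cs, st.prec⟩
  | choose (st : IState) (S' : Finset IConstraint) (P' : Finset (ℕ × ℕ))
      (x : ℕ) (ω : RelInter) (n : ℕ) (ψ χ : GIFormula) (y : ℕ)
      (h : IConstraint.sat x (.ge ω n ψ) ∈ st.cs ∨ IConstraint.sat x (.le ω n ψ) ∈ st.cs)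
      (hr : ∃ R ∈ ω.1, IConstraint.rel R x y ∈ st.cs)
      (h1 : IConstraint.sat y ψ ∉ st.cs) (h2 : IConstraint.sat y ψ.nnfNeg ∉ st.cs)
      (hχ : χ = ψ ∨ χ = ψ.nnfNeg)
      (hS' : (S' : Set IConstraint) =
        {c | c ∈ st.cs ∧ ∀ z ∈ c.vars, ¬ Relation.TransGen (precRel st.prec) y z} ∪
          {IConstraint.sat y χ})
      (hP' : (P' : Set (ℕ × ℕ)) =
        {p | p ∈ st.prec ∧ ¬ Relation.TransGen (precRel st.prec) y p.1 ∧
             ¬ Relation.TransGen (precRel st.prec) y p.2}) :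
      IStep st ⟨S', P'⟩
  | ge (st : IState) (S' : Finset IConstraint) (x : ℕ) (ω : RelInter) (n : ℕ)
      (ψ : GIFormula) (y : ℕ) (ρ : Finset GRel) (f : GIFormula → GIFormula)
      (h : IConstraint.sat x (.ge ω n ψ) ∈ st.cs)
      (hc : countI st.cs ω x ψ < n)
      (hng : ¬ iAndApplicable st.cs x ∧ ¬ iOrApplicable st.cs x ∧ ¬ iChooseApplicable st.cs x)
      (hfresh : (∀ c ∈ st.cs, y ∉ c.vars) ∧ ∀ p ∈ st.prec, y ≠ p.1 ∧ y ≠ p.2)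
      (hρ : ω.1 ⊆ ρ)
      (hf : ∀ ψ', f ψ' = ψ' ∨ f ψ' = ψ'.nnfNeg)
      (hS' : (S' : Set IConstraint) = (st.cs : Set IConstraint) ∪ {IConstraint.sat y ψ} ∪
          {c | ∃ ψ' σ m,
            (IConstraint.sat x (.ge σ m ψ') ∈ st.cs ∨ IConstraint.sat x (.le σ m ψ') ∈ st.cs) ∧
            c = IConstraint.sat y (f ψ')} ∪
          {c | ∃ R ∈ ρ, c = IConstraint.rel R x y ∨ c = IConstraint.rel R.inverse y x}) :
      IStep st ⟨S', insert (x, y) st.prec⟩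

/-- The initial state ({x₀ ⊨ φ}, ∅). -/
def initI (x₀ : ℕ) (φ : GIFormula) : IState := ⟨{IConstraint.sat x₀ φ}, ∅⟩

/-- st is obtained from ({x₀ ⊨ φ}, ∅) by a sequence of rule applications. -/
def IReach (x₀ : ℕ) (φ : GIFormula) (st : IState) : Prop :=
  Relation.ReflTransGen IStep (initI x₀ φ) st

/-- A state is complete iff no Gr(K_{R⁻¹∩})-rule is applicable. -/
def ICompleteState (st : IState) : Prop := ¬ ∃ st', IStep st st'

/-- The canonical structure induced by a Gr(K_{R⁻¹∩}) constraint system. -/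
def canonicalI (S : Finset IConstraint) : Kripke where
  W := ℕ
  nonempty := ⟨0⟩
  rel := fun r x y => IConstraint.rel (GRel.name r) x y ∈ S
  val := fun p => {x | IConstraint.sat x (.atom p) ∈ S}

/-- The inclusion of Gr(K_R)-formulae into Gr(K_{R⁻¹∩})-formulae. -/
def GFormula.toGI : GFormula → GIFormula
  | .atom p => .atom p
  | .neg φ => .neg φ.toGI
  | .and φ ψ => .and φ.toGI ψ.toGI
  | .or φ ψ => .or φ.toGI ψ.toGI
  | .ge r n φ => .ge ⟨{GRel.name r}, Finset.singleton_nonempty _⟩ n φ.toGI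
  | .le r n φ => .le ⟨{GRel.name r}, Finset.singleton_nonempty _⟩ n φ.toGI

end GrK

namespace GrK

theorem interp_iff (S : Finset IConstraint)
    (hsym : ∀ R x y, IConstraint.rel R x y ∈ S → IConstraint.rel R.inverse y x ∈ S)
    (R : GRel) (x y : ℕ) :
    GRel.interp (canonicalI S) R x y ↔ IConstraint.rel R x y ∈ S := by
  cases R with
  | name r => exact Iff.rfl
  | inv r =>
    constructor
    · intro h
      exact hsym (GRel.name r) y x h
    · intro h
      exact hsym (GRel.inv r) x y h

theorem count_finite (S : Finset IConstraint) (ω : RelInter) (x : ℕ) (ψ : GIFormula) :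
    {y : ℕ | (∀ R ∈ ω.1, IConstraint.rel R x y ∈ S) ∧ IConstraint.sat y ψ ∈ S}.Finite := by
  have h : (S : Set IConstraint).Finite := S.finite_toSet
  refine Set.Finite.subset (h.preimage (f := fun y => IConstraint.sat y ψ) ?_) ?_
  · intro a _ b _ hab
    simpa using hab
  · intro y hy
    exact hy.2

/-- Invariant of reachable states. -/
theorem reach_inv (x₀ : ℕ) (φ : GIFormula) (st : IState) (h : IReach x₀ φ st) :
    IConstraint.sat x₀ φ ∈ st.cs ∧ (∀ p ∈ st.prec, p.2 ≠ x₀) ∧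
    ∀ R x y, IConstraint.rel R x y ∈ st.cs → IConstraint.rel R.inverse y x ∈ st.cs := by
  induction h with
  | refl => simp [initI]
  | @tail a b _ hs ih =>
    obtain ⟨ih1, ih2, ih3⟩ := ih
    cases hs with
    | and x ψ₁ ψ₂ h h2 =>
      refine ⟨by simp [ih1], ih2, ?_⟩
      intro R x y h
      simp at h ⊢
      exact ih3 R x y h
    | or x ψ₁ ψ₂ χ h h1 h2 hχ =>
      refine ⟨by simp [ih1], ih2, ?_⟩
      intro R x y h
      simp at h ⊢
      exact ih3 R x y h
    | choose S' P' x ω n ψ χ y h hr h1 h2 hχ hS' hP' =>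
      have hm : ∀ c, c ∈ S' ↔ (c ∈ a.cs ∧
          ∀ z ∈ c.vars, ¬ Relation.TransGen (precRel a.prec) y z) ∨ c = IConstraint.sat y χ := by
        intro c
        rw [← Finset.mem_coe, hS']
        exact Iff.rfl
      have hp : ∀ p, p ∈ P' → p ∈ a.prec := by
        intro p hp
        rw [← Finset.mem_coe, hP'] at hp
        exact hp.1
      refine ⟨?_, fun p hp' => ih2 p (hp p hp'), ?_⟩
      · refine (hm _).2 (Or.inl ⟨ih1, ?_⟩)
        intro z hz ht
        simp [IConstraint.vars] at hz
        subst hz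
        obtain ⟨w, -, hw⟩ := Relation.TransGen.tail'_iff.1 ht
        exact ih2 _ hw rfl
      · intro R u v huv
        rcases (hm _).1 huv with ⟨h3, h4⟩ | h3
        · refine (hm _).2 (Or.inl ⟨ih3 _ _ _ h3, ?_⟩)
          intro z hz
          apply h4
          simp [IConstraint.vars] at hz ⊢
          tauto
        · simp at h3
    | ge S' x ω n ψ y ρ f h hc hng hfresh hρ hf hS' =>
      have hm : ∀ c, c ∈ S' ↔ c ∈ (S' : Set IConstraint) := fun c => Iff.rfl
      refine ⟨?_, ?_, ?_⟩
      · show _ ∈ S'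
        rw [hm, hS']
        exact Or.inl (Or.inl (Or.inl ih1))
      · intro p hp
        rcases Finset.mem_insert.1 hp with rfl | hp
        · intro he
          have he : y = x₀ := he
          exact hfresh.1 _ ih1 (by simp [IConstraint.vars, he])
        · exact ih2 p hp
      · intro R u v huv
        change _ ∈ S' at huv
        change _ ∈ S'
        rw [hm, hS'] at huv ⊢
        rcases huv with ((h3 | h3) | h3) | h3
        · exact Or.inl (Or.inl (Or.inl (ih3 _ _ _ h3)))
        · simp at h3
        · obtain ⟨_, _, _, _, h4⟩ := h3
          simp at h4
        · refine Or.inr ?_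
          obtain ⟨Q, hQ, h4 | h4⟩ := h3
          · simp at h4
            obtain ⟨rfl, rfl, rfl⟩ := h4
            exact ⟨R, hQ, Or.inr rfl⟩
          · simp at h4
            obtain ⟨rfl, rfl, rfl⟩ := h4
            refine ⟨Q, hQ, Or.inl ?_⟩
            cases Q <;> rfl

theorem complete_and (st : IState) (hcomp : ICompleteState st) (x : ℕ) :
    ¬ iAndApplicable st.cs x := by
  rintro ⟨ψ₁, ψ₂, h, h2⟩
  exact hcomp ⟨_, IStep.and st x ψ₁ ψ₂ h h2⟩

theorem complete_or (st : IState) (hcomp : ICompleteState st) (x : ℕ) :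
    ¬ iOrApplicable st.cs x := by
  rintro ⟨ψ₁, ψ₂, h, h1, h2⟩
  exact hcomp ⟨_, IStep.or st x ψ₁ ψ₂ ψ₁ h h1 h2 (Or.inl rfl)⟩

theorem complete_choose (st : IState) (hcomp : ICompleteState st) (x : ℕ) :
    ¬ iChooseApplicable st.cs x := by
  rintro ⟨ω, n, ψ, y, h, hr, h1, h2⟩
  have f1 : ({c | c ∈ st.cs ∧ ∀ z ∈ c.vars, ¬ Relation.TransGen (precRel st.prec) y z} ∪
          {IConstraint.sat y ψ} : Set IConstraint).Finite :=
    (st.cs.finite_toSet.subset (fun c hc => hc.1)).union (Set.finite_singleton _)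
  have f2 : ({p | p ∈ st.prec ∧ ¬ Relation.TransGen (precRel st.prec) y p.1 ∧
             ¬ Relation.TransGen (precRel st.prec) y p.2} : Set (ℕ × ℕ)).Finite :=
    st.prec.finite_toSet.subset (fun c hc => hc.1)
  exact hcomp ⟨_, IStep.choose st f1.toFinset f2.toFinset x ω n ψ ψ y h hr h1 h2 (Or.inl rfl)
    f1.coe_toFinset f2.coe_toFinset⟩

theorem complete_ge (st : IState) (hcomp : ICompleteState st) (x : ℕ) (ω : RelInter) (n : ℕ)
    (ψ : GIFormula) (h : IConstraint.sat x (.ge ω n ψ) ∈ st.cs) : n ≤ countI st.cs ω x ψ := by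
  by_contra hc
  push Not at hc
  obtain ⟨y, hy⟩ := Infinite.exists_notMem_finset
    (st.cs.biUnion IConstraint.vars ∪ st.prec.image Prod.fst ∪ st.prec.image Prod.snd)
  simp only [Finset.mem_union, not_or, Finset.mem_biUnion, Finset.mem_image, not_exists,
    not_and] at hy
  obtain ⟨⟨hy1, hy2⟩, hy3⟩ := hy
  have f1 : ((st.cs : Set IConstraint) ∪ {IConstraint.sat y ψ} ∪
          {c | ∃ ψ' σ m,
            (IConstraint.sat x (.ge σ m ψ') ∈ st.cs ∨ IConstraint.sat x (.le σ m ψ') ∈ st.cs) ∧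
            c = IConstraint.sat y (id ψ')} ∪
          {c | ∃ R ∈ ω.1, c = IConstraint.rel R x y ∨
            c = IConstraint.rel R.inverse y x}).Finite := by
    refine Set.Finite.union (Set.Finite.union (st.cs.finite_toSet.union
      (Set.finite_singleton _)) ?_) ?_
    · refine (st.cs.finite_toSet.image (fun c => match c with
        | IConstraint.sat _ (.ge _ _ ψ') => IConstraint.sat y ψ'
        | IConstraint.sat _ (.le _ _ ψ') => IConstraint.sat y ψ'
        | c => c)).subset ?_
      rintro c ⟨ψ', σ, m, h | h, rfl⟩
      · exact ⟨_, h, rfl⟩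
      · exact ⟨_, h, rfl⟩
    · refine ((ω.1.finite_toSet.image (fun R => IConstraint.rel R x y)).union
        (ω.1.finite_toSet.image (fun R => IConstraint.rel R.inverse y x))).subset ?_
      rintro c ⟨R, hR, rfl | rfl⟩
      · exact Or.inl ⟨R, hR, rfl⟩
      · exact Or.inr ⟨R, hR, rfl⟩
  exact hcomp ⟨_, IStep.ge st f1.toFinset x ω n ψ y ω.1 id h hc
    ⟨complete_and st hcomp x, complete_or st hcomp x, complete_choose st hcomp x⟩
    ⟨hy1, fun p hp => ⟨fun e => hy2 p hp e.symm, fun e => hy3 p hp e.symm⟩⟩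
    (Finset.Subset.refl _) (fun _ => Or.inl rfl) f1.coe_toFinset⟩

theorem truth (st : IState) (hcomp : ICompleteState st) (hcf : ¬ hasClashI st.cs)
    (hsym : ∀ R x y, IConstraint.rel R x y ∈ st.cs → IConstraint.rel R.inverse y x ∈ st.cs)
    (ψ : GIFormula) (hN : ψ.isNNF) : ∀ x : ℕ,
    (IConstraint.sat x ψ ∈ st.cs → GIFormula.sat (canonicalI st.cs) ψ x) ∧
    (IConstraint.sat x ψ.nnfNeg ∈ st.cs → ¬ GIFormula.sat (canonicalI st.cs) ψ x) := by
  have hatom : ∀ x p, IConstraint.sat x (.atom p) ∈ st.cs →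
      IConstraint.sat x (.neg (.atom p)) ∈ st.cs → False :=
    fun x p h1 h2 => hcf (Or.inl ⟨x, p, h1, h2⟩)
  have hand : ∀ x ψ₁ ψ₂, IConstraint.sat x (.and ψ₁ ψ₂) ∈ st.cs →
      IConstraint.sat x ψ₁ ∈ st.cs ∧ IConstraint.sat x ψ₂ ∈ st.cs := by
    intro x ψ₁ ψ₂ h
    by_contra h2
    exact complete_and st hcomp x ⟨ψ₁, ψ₂, h, h2⟩
  have hor : ∀ x ψ₁ ψ₂, IConstraint.sat x (.or ψ₁ ψ₂) ∈ st.cs →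
      IConstraint.sat x ψ₁ ∈ st.cs ∨ IConstraint.sat x ψ₂ ∈ st.cs := by
    intro x ψ₁ ψ₂ h
    by_contra h2
    push Not at h2
    exact complete_or st hcomp x ⟨ψ₁, ψ₂, h, h2⟩
  have hge : ∀ (ψ : GIFormula) (_ : ∀ x : ℕ,
      (IConstraint.sat x ψ ∈ st.cs → GIFormula.sat (canonicalI st.cs) ψ x) ∧
      (IConstraint.sat x ψ.nnfNeg ∈ st.cs → ¬ GIFormula.sat (canonicalI st.cs) ψ x))
      (x : ℕ) (ω : RelInter) (n : ℕ), IConstraint.sat x (.ge ω n ψ) ∈ st.cs →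
      GIFormula.sat (canonicalI st.cs) (.ge ω n ψ) x := by
    intro ψ ih x ω n h
    have h1 := complete_ge st hcomp x ω n ψ h
    have hfin := count_finite st.cs ω x ψ
    have h2 : ((countI st.cs ω x ψ : ℕ) : Cardinal) = Cardinal.mk
        {y : ℕ | (∀ R ∈ ω.1, IConstraint.rel R x y ∈ st.cs) ∧ IConstraint.sat y ψ ∈ st.cs} :=
      Set.cast_ncard hfin
    have h3 : Cardinal.mk
        {y : ℕ | (∀ R ∈ ω.1, IConstraint.rel R x y ∈ st.cs) ∧ IConstraint.sat y ψ ∈ st.cs} ≤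
        Cardinal.mk {y : ℕ | (∀ R ∈ ω.1, GRel.interp (canonicalI st.cs) R x y) ∧
          GIFormula.sat (canonicalI st.cs) ψ y} := by
      apply Cardinal.mk_le_mk_of_subset
      rintro y ⟨ha, hb⟩
      exact ⟨fun R hR => (interp_iff st.cs hsym R x y).2 (ha R hR), (ih y).1 hb⟩
    have h4 : (n : Cardinal) ≤ (countI st.cs ω x ψ : ℕ) := by exact_mod_cast h1
    exact (h4.trans h2.le).trans h3
  have hle : ∀ (ψ : GIFormula) (_ : ∀ x : ℕ,
      (IConstraint.sat x ψ ∈ st.cs → GIFormula.sat (canonicalI st.cs) ψ x) ∧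
      (IConstraint.sat x ψ.nnfNeg ∈ st.cs → ¬ GIFormula.sat (canonicalI st.cs) ψ x))
      (x : ℕ) (ω : RelInter) (n : ℕ), IConstraint.sat x (.le ω n ψ) ∈ st.cs →
      GIFormula.sat (canonicalI st.cs) (.le ω n ψ) x := by
    intro ψ ih x ω n h
    have h1 : countI st.cs ω x ψ ≤ n := by
      by_contra hc
      push Not at hc
      exact hcf (Or.inr ⟨x, ω, n, ψ, h, hc⟩)
    have hfin := count_finite st.cs ω x ψ
    have h2 : ((countI st.cs ω x ψ : ℕ) : Cardinal) = Cardinal.mk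
        {y : ℕ | (∀ R ∈ ω.1, IConstraint.rel R x y ∈ st.cs) ∧ IConstraint.sat y ψ ∈ st.cs} :=
      Set.cast_ncard hfin
    have h3 : Cardinal.mk {y : ℕ | (∀ R ∈ ω.1, GRel.interp (canonicalI st.cs) R x y) ∧
          GIFormula.sat (canonicalI st.cs) ψ y} ≤ Cardinal.mk
        {y : ℕ | (∀ R ∈ ω.1, IConstraint.rel R x y ∈ st.cs) ∧
          IConstraint.sat y ψ ∈ st.cs} := by
      apply Cardinal.mk_le_mk_of_subset
      rintro y ⟨ha, hb⟩
      have ha' : ∀ R ∈ ω.1, IConstraint.rel R x y ∈ st.cs :=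
        fun R hR => (interp_iff st.cs hsym R x y).1 (ha R hR)
      refine ⟨ha', ?_⟩
      by_contra hn
      obtain ⟨R, hR⟩ := ω.2
      refine complete_choose st hcomp x ⟨ω, n, ψ, y, Or.inr h, ⟨R, hR, ha' R hR⟩, hn, ?_⟩
      exact fun hn' => (ih y).2 hn' hb
    have h4 : ((countI st.cs ω x ψ : ℕ) : Cardinal) ≤ n := by exact_mod_cast h1
    exact (h3.trans h2.ge).trans h4
  induction ψ with
  | atom p =>
    exact fun x => ⟨fun h => h, fun h h' => hatom x p h' h⟩
  | neg φ ih =>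
    cases φ with
    | atom p => exact fun x => ⟨fun h h' => hatom x p h' h, fun h h' => h' h⟩
    | _ => exact absurd hN (by simp [GIFormula.isNNF])
  | and φ₁ φ₂ ih1 ih2 =>
    intro x
    refine ⟨fun h => ?_, fun h h' => ?_⟩
    · have := hand _ _ _ h
      exact ⟨(ih1 hN.1 x).1 this.1, (ih2 hN.2 x).1 this.2⟩
    · rcases hor _ _ _ h with h | h
      · exact (ih1 hN.1 x).2 h h'.1
      · exact (ih2 hN.2 x).2 h h'.2
  | or φ₁ φ₂ ih1 ih2 =>
    intro x
    refine ⟨fun h => ?_, fun h h' => ?_⟩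
    · exact (hor _ _ _ h).imp (ih1 hN.1 x).1 (ih2 hN.2 x).1
    · have := hand _ _ _ h
      rcases h' with h' | h'
      · exact (ih1 hN.1 x).2 this.1 h'
      · exact (ih2 hN.2 x).2 this.2 h'
  | ge ω n φ ih =>
    intro x
    refine ⟨hge φ (ih hN) x ω n, fun h h' => ?_⟩
    rw [GIFormula.nnfNeg] at h
    split_ifs at h with hn
    · have := hand _ _ _ h
      exact hatom _ _ this.1 this.2
    · have h2 := hle φ (ih hN) x ω (n - 1) h
      have h3 : (n : Cardinal) ≤ ((n - 1 : ℕ) : Cardinal) := le_trans h' h2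
      have h4 : n ≤ n - 1 := by exact_mod_cast h3
      omega
  | le ω n φ ih =>
    intro x
    refine ⟨hle φ (ih hN) x ω n, fun h h' => ?_⟩
    have h2 := hge φ (ih hN) x ω (n + 1) h
    have h3 : ((n + 1 : ℕ) : Cardinal) ≤ (n : Cardinal) := le_trans h2 h'
    have h4 : n + 1 ≤ n := by exact_mod_cast h3
    omega

end GrK

open GrK in
/-- soundness of the Gr(K_{R⁻¹∩})-algorithm: if the rules can be
applied to {x₀ ⊨ φ} (φ in NNF) to yield a complete and clash-free constraint
system S, then φ is satisfiable; indeed M_S, x₀ ⊨ φ for the canonical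
structure M_S. -/
theorem stmt_17 (φ : GIFormula) (hNNF : φ.isNNF) (x₀ : ℕ) (st : IState)
    (hreach : IReach x₀ φ st) (hcomp : ICompleteState st) (hcf : ¬ hasClashI st.cs) :
    GIFormula.sat (canonicalI st.cs) φ x₀ ∧ φ.satisfiable := by
  obtain ⟨h1, -, h3⟩ := reach_inv x₀ φ st hreach
  have h := (truth st hcomp hcf h3 φ hNNF x₀).1 h1
  exact ⟨h, canonicalI st.cs, x₀, h⟩
end
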